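/- For each N ≥ 1, let A_N be a random N×N complex matrix and let x_N, y_N ∈ ℂ^N be random vectors whose entries are i.i.d. complex random variables of zero mean, unit variance, and finite eighth-order moment, such that x_N, y_N and A_N are mutually independent. Assume lim sup_N ‖A_N‖₂ < ∞ almost surely. Then (1/N)·x_N^H A_N y_N → 0 almost surely as N → ∞. -/

import Mathlib

open MeasureTheory ProbabilityTheory Filter Matrix

/-- The spectral norm (largest singular value) of a complex matrix. -/
noncomputable def specNorm {m n : Type*} [Fintype m] [Fintype n] [DecidableEq n]
    (A : Matrix m n ℂ) : ℝ :=
  ‖LinearMap.toContinuousLinearMap (Matrix.toEuclideanLin A)‖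

open scoped ComplexConjugate ENNReal

/-- An expansion of `‖s + a‖ ^ 4` in which the only term of degree one in `a` is kept exactly. -/
lemma Complex.norm_add_pow_four_le (s a : ℂ) :
    ‖s + a‖ ^ 4 ≤ ‖s‖ ^ 4 + 4 * ((‖s‖ ^ 2 : ℝ) * s * conj a).re
      + 8 * (‖s‖ ^ 2 * ‖a‖ ^ 2) + 3 * ‖a‖ ^ 4 := by
  have hsq : ‖s + a‖ ^ 2 = ‖s‖ ^ 2 + ‖a‖ ^ 2 + 2 * (s * conj a).re := by
    simp only [← Complex.normSq_eq_norm_sq, Complex.normSq_add]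
  have hre : |(s * conj a).re| ≤ ‖s‖ * ‖a‖ := by
    simpa using Complex.abs_re_le_norm (s * conj a)
  have hmul : ((‖s‖ ^ 2 : ℝ) * s * conj a).re = ‖s‖ ^ 2 * (s * conj a).re := by
    rw [mul_assoc, Complex.re_ofReal_mul]
  have hpow : ‖s + a‖ ^ 4 = (‖s + a‖ ^ 2) ^ 2 := by ring
  rw [hmul, hpow, hsq]
  generalize (s * conj a).re = r at hre
  have hs := norm_nonneg s
  have ha := norm_nonneg a
  generalize ‖s‖ = p at *
  generalize ‖a‖ = q at *
  have h1 : r ^ 2 ≤ p ^ 2 * q ^ 2 := by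
    rw [← mul_pow]; exact sq_le_sq' (abs_le.1 hre).1 (abs_le.1 hre).2
  have h2 : q ^ 2 * r ≤ q ^ 2 * (p * q) :=
    mul_le_mul_of_nonneg_left (abs_le.1 hre).2 (sq_nonneg q)
  have h3 : 0 ≤ q ^ 2 * (p - q) ^ 2 := by positivity
  nlinarith

section IndependentSums

variable {Ω : Type*} [MeasurableSpace Ω] {μ : Measure Ω} [IsProbabilityMeasure μ]

lemma MeasureTheory.MemLp.integrable_norm_pow_of_le_four {X : Ω → ℂ} (hX : MemLp X 4 μ) {k : ℕ}
    (hk : k ≤ 4) : Integrable (fun ω => ‖X ω‖ ^ k) μ :=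
  integrable_norm_pow_of_le hX.1 hk (MemLp.integrable_norm_pow (p := 4) hX (by norm_num))

/-- The second moment is additive over independent summands, one of which is centred. -/
lemma ProbabilityTheory.IndepFun.integral_norm_add_sq {S X : Ω → ℂ} (h : IndepFun S X μ)
    (hS : MemLp S 4 μ) (hX : MemLp X 4 μ) (hX0 : ∫ ω, X ω ∂μ = 0) :
    ∫ ω, ‖S ω + X ω‖ ^ 2 ∂μ = ∫ ω, ‖S ω‖ ^ 2 ∂μ + ∫ ω, ‖X ω‖ ^ 2 ∂μ := by
  have hind : IndepFun S (fun ω => conj (X ω)) μ :=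
    h.comp (φ := id) (ψ := fun z : ℂ => conj z) measurable_id (by fun_prop)
  have hXc : Integrable (fun ω => conj (X ω)) μ :=
    hX.star.integrable (by norm_num)
  have hint : Integrable (fun ω => S ω * conj (X ω)) μ :=
    hind.integrable_mul (hS.integrable (by norm_num)) hXc
  have hzero : ∫ ω, S ω * conj (X ω) ∂μ = 0 := by
    rw [hind.integral_fun_mul_eq_mul_integral hS.1 hXc.1, integral_conj, hX0]
    simp
  have hre : ∫ ω, (S ω * conj (X ω)).re ∂μ = 0 := by
    simpa [hzero] using integral_re hint
  have hexp : ∀ ω, ‖S ω + X ω‖ ^ 2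
      = ‖S ω‖ ^ 2 + ‖X ω‖ ^ 2 + 2 * (S ω * conj (X ω)).re := fun ω => by
    simp only [← Complex.normSq_eq_norm_sq, Complex.normSq_add]
  have hS2 := hS.integrable_norm_pow_of_le_four (k := 2) (by norm_num)
  have hX2 := hX.integrable_norm_pow_of_le_four (k := 2) (by norm_num)
  have hr : Integrable (fun ω => (S ω * conj (X ω)).re) μ := hint.re
  simp_rw [hexp]
  rw [integral_add (hS2.fun_add hX2) (hr.const_mul 2), integral_add hS2 hX2, integral_const_mul, hre]
  simp

lemma ProbabilityTheory.IndepFun.integral_norm_add_pow_four_le {S X : Ω → ℂ}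
    (h : IndepFun S X μ) (hS : MemLp S 4 μ) (hX : MemLp X 4 μ) (hX0 : ∫ ω, X ω ∂μ = 0) :
    ∫ ω, ‖S ω + X ω‖ ^ 4 ∂μ ≤ ∫ ω, ‖S ω‖ ^ 4 ∂μ
      + 8 * ((∫ ω, ‖S ω‖ ^ 2 ∂μ) * ∫ ω, ‖X ω‖ ^ 2 ∂μ) + 3 * ∫ ω, ‖X ω‖ ^ 4 ∂μ := by
  have hind : IndepFun (fun ω => ((‖S ω‖ ^ 2 : ℝ) : ℂ) * S ω) (fun ω => conj (X ω)) μ :=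
    h.comp (φ := fun z : ℂ => ((‖z‖ ^ 2 : ℝ) : ℂ) * z) (ψ := fun z : ℂ => conj z)
      (by fun_prop) (by fun_prop)
  have hind2 : IndepFun (fun ω => ‖S ω‖ ^ 2) (fun ω => ‖X ω‖ ^ 2) μ :=
    h.comp (φ := fun z : ℂ => ‖z‖ ^ 2) (ψ := fun z : ℂ => ‖z‖ ^ 2) (by fun_prop) (by fun_prop)
  have hXc : Integrable (fun ω => conj (X ω)) μ :=
    hX.star.integrable (by norm_num)
  have hS3 : Integrable (fun ω => ((‖S ω‖ ^ 2 : ℝ) : ℂ) * S ω) μ := by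
    refine (hS.integrable_norm_pow_of_le_four (k := 3) (by norm_num)).congr'
      ((by fun_prop : Continuous fun z : ℂ => ((‖z‖ ^ 2 : ℝ) : ℂ) * z).comp_aestronglyMeasurable
        hS.1) (.of_forall fun ω => ?_)
    simp [pow_succ]
  have hint : Integrable (fun ω => ((‖S ω‖ ^ 2 : ℝ) : ℂ) * S ω * conj (X ω)) μ :=
    hind.integrable_mul hS3 hXc
  have hzero : ∫ ω, ((‖S ω‖ ^ 2 : ℝ) : ℂ) * S ω * conj (X ω) ∂μ = 0 := by
    rw [hind.integral_fun_mul_eq_mul_integral hS3.1 hXc.1, integral_conj, hX0]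
    simp
  have hre : ∫ ω, (((‖S ω‖ ^ 2 : ℝ) : ℂ) * S ω * conj (X ω)).re ∂μ = 0 :=
    (integral_re hint).trans (by rw [hzero]; simp)
  have hr : Integrable (fun ω => (((‖S ω‖ ^ 2 : ℝ) : ℂ) * S ω * conj (X ω)).re) μ := hint.re
  have hS2 := hS.integrable_norm_pow_of_le_four (k := 2) (by norm_num)
  have hX2 := hX.integrable_norm_pow_of_le_four (k := 2) (by norm_num)
  have hS4 := hS.integrable_norm_pow_of_le_four (k := 4) le_rfl
  have hX4 := hX.integrable_norm_pow_of_le_four (k := 4) le_rfl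
  have hSX : Integrable (fun ω => ‖S ω‖ ^ 2 * ‖X ω‖ ^ 2) μ := hind2.integrable_mul hS2 hX2
  calc ∫ ω, ‖S ω + X ω‖ ^ 4 ∂μ
      ≤ ∫ ω, (‖S ω‖ ^ 4 + 4 * (((‖S ω‖ ^ 2 : ℝ) : ℂ) * S ω * conj (X ω)).re
          + 8 * (‖S ω‖ ^ 2 * ‖X ω‖ ^ 2) + 3 * ‖X ω‖ ^ 4) ∂μ :=
        integral_mono ((hS.add hX).integrable_norm_pow_of_le_four le_rfl)
          (((hS4.fun_add (hr.const_mul 4)).fun_add (hSX.const_mul 8)).fun_add (hX4.const_mul 3))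
          fun ω => Complex.norm_add_pow_four_le _ _
    _ = _ := by
        rw [integral_add ((hS4.fun_add (hr.const_mul 4)).fun_add (hSX.const_mul 8)) (hX4.const_mul 3),
          integral_add (hS4.fun_add (hr.const_mul 4)) (hSX.const_mul 8),
          integral_add hS4 (hr.const_mul 4), integral_const_mul, integral_const_mul,
          integral_const_mul, hre, hind2.integral_fun_mul_eq_mul_integral hS2.1 hX2.1]
        simp

/-- A Rosenthal-type bound: if independent centred `X i` have second moment at most `s i` and
fourth moment at most `m * s i ^ 2`, then the fourth moment of their sum is at most
`(4 + 3 * m) * (∑ i, s i) ^ 2`. -/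
lemma ProbabilityTheory.iIndepFun.integral_norm_sum_pow_four_le {ι : Type*} {X : ι → Ω → ℂ}
    (hind : iIndepFun X μ) (hmeas : ∀ i, Measurable (X i)) (hX : ∀ i, MemLp (X i) 4 μ)
    (hX0 : ∀ i, ∫ ω, X i ω ∂μ = 0) {m : ℝ} (hm : 0 ≤ m) {s : ι → ℝ}
    (h2 : ∀ i, ∫ ω, ‖X i ω‖ ^ 2 ∂μ ≤ s i) (h4 : ∀ i, ∫ ω, ‖X i ω‖ ^ 4 ∂μ ≤ m * s i ^ 2)
    (t : Finset ι) :
    ∫ ω, ‖∑ i ∈ t, X i ω‖ ^ 4 ∂μ ≤ (4 + 3 * m) * (∑ i ∈ t, s i) ^ 2 := by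
  classical
  suffices H : ∫ ω, ‖∑ i ∈ t, X i ω‖ ^ 2 ∂μ ≤ ∑ i ∈ t, s i ∧
      ∫ ω, ‖∑ i ∈ t, X i ω‖ ^ 4 ∂μ ≤ (4 + 3 * m) * (∑ i ∈ t, s i) ^ 2 from H.2
  induction t using Finset.induction_on with
  | empty => simp
  | insert i t hi ih =>
    obtain ⟨ih2, ih4⟩ := ih
    have hi' : IndepFun (fun ω => ∑ j ∈ t, X j ω) (X i) μ := by
      simpa only [Finset.sum_fn] using hind.indepFun_finsetSum_of_notMem hmeas hi
    have hS : MemLp (fun ω => ∑ j ∈ t, X j ω) 4 μ := memLp_finsetSum t fun j _ => hX j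
    have e2 := hi'.integral_norm_add_sq hS (hX i) (hX0 i)
    have e4 := hi'.integral_norm_add_pow_four_le hS (hX i) (hX0 i)
    simp_rw [Finset.sum_insert hi, add_comm (X i _), add_comm (s i)]
    have hS2 : 0 ≤ ∫ ω, ‖∑ j ∈ t, X j ω‖ ^ 2 ∂μ := integral_nonneg fun ω => by positivity
    have hX2 : 0 ≤ ∫ ω, ‖X i ω‖ ^ 2 ∂μ := integral_nonneg fun ω => by positivity
    have hprod := mul_le_mul ih2 (h2 i) hX2 (hS2.trans ih2)
    refine ⟨by linarith [h2 i], ?_⟩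
    have hts := mul_nonneg (hS2.trans ih2) (hX2.trans (h2 i))
    nlinarith [h4 i, mul_nonneg hm hts, sq_nonneg (s i)]

end IndependentSums

section ProductMeasure

variable {ν : Measure ℂ} [IsProbabilityMeasure ν] {ι : Type*} [Fintype ι]

lemma memLp_star_dotProduct (hL : MemLp (fun z : ℂ => z) 4 ν) (v : ι → ℂ) :
    MemLp (fun x : ι → ℂ => star x ⬝ᵥ v) 4 (Measure.pi fun _ : ι => ν) :=
  memLp_finsetSum Finset.univ fun i _ =>
    (hL.comp_measurePreserving (measurePreserving_eval (fun _ : ι => ν) i)).star.mul_const (v i)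

/-- The fourth moment of a linear form in i.i.d. standardized coordinates. -/
lemma integral_norm_star_dotProduct_pow_four_le (hmean : ∫ z, z ∂ν = 0)
    (hvar : ∫ z, ‖z‖ ^ 2 ∂ν = 1) (hL : MemLp (fun z : ℂ => z) 4 ν) (v : ι → ℂ) :
    ∫ x, ‖star x ⬝ᵥ v‖ ^ 4 ∂(Measure.pi fun _ : ι => ν)
      ≤ (4 + 3 * ∫ z, ‖z‖ ^ 4 ∂ν) * (∑ i, ‖v i‖ ^ 2) ^ 2 := by
  have hev : ∀ i, MemLp (fun x : ι → ℂ => conj (x i)) 4 (Measure.pi fun _ : ι => ν) := fun i =>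
    (hL.comp_measurePreserving (measurePreserving_eval (fun _ : ι => ν) i)).star
  have hind : iIndepFun (fun i (x : ι → ℂ) => conj (x i) * v i) (Measure.pi fun _ : ι => ν) :=
    iIndepFun_pi (X := fun i (z : ℂ) => conj z * v i) fun i => by fun_prop
  refine hind.integral_norm_sum_pow_four_le (fun i => by fun_prop)
    (fun i => (hev i).mul_const (v i)) (fun i => ?_)
    (integral_nonneg fun z => by positivity) (fun i => ?_) (fun i => ?_) Finset.univ
  · rw [integral_mul_const, integral_conj,
      integral_comp_eval (μ := fun _ : ι => ν) (f := fun z : ℂ => z) (by fun_prop), hmean]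
    simp
  · simp_rw [norm_mul, mul_pow, RCLike.norm_conj]
    rw [integral_mul_const,
      integral_comp_eval (μ := fun _ : ι => ν) (f := fun z : ℂ => ‖z‖ ^ 2) (by fun_prop), hvar,
      one_mul]
  · simp_rw [norm_mul, mul_pow, RCLike.norm_conj]
    rw [integral_mul_const,
      integral_comp_eval (μ := fun _ : ι => ν) (f := fun z : ℂ => ‖z‖ ^ 4) (by fun_prop)]
    exact le_of_eq (by ring)

lemma integral_sum_norm_sq_sq_le (hL : MemLp (fun z : ℂ => z) 4 ν) :
    Integrable (fun x : ι → ℂ => (∑ i, ‖x i‖ ^ 2) ^ 2) (Measure.pi fun _ : ι => ν) ∧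
    ∫ x, (∑ i, ‖x i‖ ^ 2) ^ 2 ∂(Measure.pi fun _ : ι => ν)
      ≤ (∫ z, ‖z‖ ^ 4 ∂ν) * (Fintype.card ι : ℝ) ^ 2 := by
  have h4 : ∀ i, Integrable (fun x : ι → ℂ => ‖x i‖ ^ 4) (Measure.pi fun _ : ι => ν) := fun i =>
    integrable_comp_eval (μ := fun _ : ι => ν) (f := fun z : ℂ => ‖z‖ ^ 4)
      (hL.integrable_norm_pow_of_le_four le_rfl)
  have hle : ∀ x : ι → ℂ, (∑ i, ‖x i‖ ^ 2) ^ 2 ≤ Fintype.card ι * ∑ i, ‖x i‖ ^ 4 := fun x => by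
    simp_rw [show ∀ r : ℝ, r ^ 4 = (r ^ 2) ^ 2 from fun r => by ring]
    exact sq_sum_le_card_mul_sum_sq (s := Finset.univ) (f := fun i => ‖x i‖ ^ 2)
  have hint := (integrable_finsetSum Finset.univ fun i _ => h4 i).const_mul (Fintype.card ι : ℝ)
  have hI : Integrable (fun x : ι → ℂ => (∑ i, ‖x i‖ ^ 2) ^ 2) (Measure.pi fun _ : ι => ν) :=
    hint.mono' (by fun_prop : Continuous fun x : ι → ℂ =>
      (∑ i, ‖x i‖ ^ 2) ^ 2).aestronglyMeasurable (.of_forall fun x => by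
      rw [Real.norm_of_nonneg (by positivity)]; exact hle x)
  refine ⟨hI, (integral_mono hI hint hle).trans (le_of_eq ?_)⟩
  rw [integral_const_mul, integral_finsetSum _ fun i _ => h4 i]
  simp_rw [fun i => integral_comp_eval (μ := fun _ : ι => ν) (i := i) (f := fun z : ℂ => ‖z‖ ^ 4)
    (by fun_prop)]
  rw [Finset.sum_const, Finset.card_univ, nsmul_eq_mul]
  ring

end ProductMeasure

section SpecNorm

variable {m n : Type*} [Fintype m] [Fintype n] [DecidableEq n]

lemma sum_norm_mulVec_sq_le (A : Matrix m n ℂ) (y : n → ℂ) :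
    ∑ i, ‖(A *ᵥ y) i‖ ^ 2 ≤ specNorm A ^ 2 * ∑ i, ‖y i‖ ^ 2 := by
  have h := (LinearMap.toContinuousLinearMap (Matrix.toEuclideanLin A)).le_opNorm
    (WithLp.toLp 2 y)
  have h' := pow_le_pow_left₀ (norm_nonneg _) h 2
  rw [mul_pow, EuclideanSpace.norm_sq_eq, EuclideanSpace.norm_sq_eq] at h'
  simpa [specNorm] using h'

lemma measurable_specNorm_of :
    Measurable fun a : m × n → ℂ => specNorm (Matrix.of fun i j => a (i, j)) := by
  let L : (m × n → ℂ) →ₗ[ℂ] (EuclideanSpace ℂ n →L[ℂ] EuclideanSpace ℂ m) :=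
    { toFun := fun a => LinearMap.toContinuousLinearMap
        (Matrix.toEuclideanLin (Matrix.of fun i j => a (i, j)))
      map_add' := fun a b => by rw [← map_add, ← map_add]; rfl
      map_smul' := fun c a => by
        rw [RingHom.id_apply, ← map_smul, ← map_smul]; rfl }
  exact (L.continuous_of_finiteDimensional.norm).measurable

end SpecNorm

section BilinearForm

variable {Ω : Type*} [MeasurableSpace Ω] {μ : Measure Ω} [IsProbabilityMeasure μ]
  {ν : Measure ℂ} [IsProbabilityMeasure ν] {ι : Type*} [Fintype ι] [DecidableEq ι]

/-- For a fixed matrix, the fourth moment of a bilinear form in two independent vectors with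
i.i.d. standardized coordinates is controlled by the spectral norm. -/
lemma lintegral_lintegral_enorm_bilinear_pow_four_le (hmean : ∫ z, z ∂ν = 0)
    (hvar : ∫ z, ‖z‖ ^ 2 ∂ν = 1) (hL : MemLp (fun z : ℂ => z) 4 ν) (A : Matrix ι ι ℂ) {C : ℝ}
    (hA : specNorm A ≤ C) :
    ∫⁻ y, ∫⁻ x, ‖star x ⬝ᵥ A *ᵥ y‖ₑ ^ 4 ∂(Measure.pi fun _ : ι => ν)
        ∂(Measure.pi fun _ : ι => ν)
      ≤ ENNReal.ofReal ((4 + 3 * ∫ z, ‖z‖ ^ 4 ∂ν) * C ^ 4 * ((∫ z, ‖z‖ ^ 4 ∂ν)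
        * (Fintype.card ι : ℝ) ^ 2)) := by
  have hm : 0 ≤ ∫ z, ‖z‖ ^ 4 ∂ν := integral_nonneg fun z => by positivity
  have hA0 : 0 ≤ specNorm A := norm_nonneg _
  obtain ⟨hI, hle⟩ := integral_sum_norm_sq_sq_le (ι := ι) hL
  have hinner : ∀ y : ι → ℂ,
      ∫⁻ x, ‖star x ⬝ᵥ A *ᵥ y‖ₑ ^ 4 ∂(Measure.pi fun _ : ι => ν)
        ≤ ENNReal.ofReal ((4 + 3 * ∫ z, ‖z‖ ^ 4 ∂ν) * C ^ 4 * (∑ i, ‖y i‖ ^ 2) ^ 2) := by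
    intro y
    simp_rw [← ofReal_norm, ← ENNReal.ofReal_pow (norm_nonneg _)]
    rw [← ofReal_integral_eq_lintegral_ofReal
      ((memLp_star_dotProduct hL _).integrable_norm_pow_of_le_four le_rfl)
      (.of_forall fun x => by positivity)]
    refine ENNReal.ofReal_le_ofReal
      ((integral_norm_star_dotProduct_pow_four_le hmean hvar hL _).trans ?_)
    rw [mul_assoc]
    refine mul_le_mul_of_nonneg_left ?_ (by positivity)
    calc (∑ i, ‖(A *ᵥ y) i‖ ^ 2) ^ 2 ≤ (C ^ 2 * ∑ i, ‖y i‖ ^ 2) ^ 2 := by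
          gcongr
          exact (sum_norm_mulVec_sq_le A y).trans (by gcongr)
      _ = C ^ 4 * (∑ i, ‖y i‖ ^ 2) ^ 2 := by ring
  refine (lintegral_mono hinner).trans ?_
  rw [← ofReal_integral_eq_lintegral_ofReal (hI.const_mul _)
    (.of_forall fun y => by positivity), integral_const_mul]
  exact ENNReal.ofReal_le_ofReal (mul_le_mul_of_nonneg_left hle (by positivity))

/-- The fourth moment of the bilinear form, with the random matrix restricted to the event that
its spectral norm is at most `C`. -/
lemma lintegral_indicator_enorm_bilinear_pow_four_le {A : Ω → Matrix ι ι ℂ} {x y : Ω → ι → ℂ}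
    (hmean : ∫ z, z ∂ν = 0) (hvar : ∫ z, ‖z‖ ^ 2 ∂ν = 1) (hL : MemLp (fun z : ℂ => z) 4 ν)
    (hx : Measurable x) (hy : Measurable y)
    (hA : Measurable fun ω (p : ι × ι) => A ω p.1 p.2)
    (hxlaw : Measure.map x μ = Measure.pi fun _ : ι => ν)
    (hylaw : Measure.map y μ = Measure.pi fun _ : ι => ν)
    (hxy : IndepFun x y μ)
    (hxyA : IndepFun (fun ω => (x ω, y ω)) (fun ω (p : ι × ι) => A ω p.1 p.2) μ) (C : ℝ) :
    Measurable ({ω | specNorm (A ω) ≤ C}.indicator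
      fun ω => ‖star (x ω) ⬝ᵥ A ω *ᵥ y ω‖ₑ ^ 4) ∧
    ∫⁻ ω, {ω | specNorm (A ω) ≤ C}.indicator
        (fun ω => ‖star (x ω) ⬝ᵥ A ω *ᵥ y ω‖ₑ ^ 4) ω ∂μ
      ≤ ENNReal.ofReal ((4 + 3 * ∫ z, ‖z‖ ^ 4 ∂ν) * C ^ 4 * ((∫ z, ‖z‖ ^ 4 ∂ν)
        * (Fintype.card ι : ℝ) ^ 2)) := by
  let F : ((ι → ℂ) × (ι → ℂ)) × (ι × ι → ℂ) → ℝ≥0∞ :=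
    {q | specNorm (Matrix.of fun i j => q.2 (i, j)) ≤ C}.indicator
      fun q => ‖star q.1.1 ⬝ᵥ (Matrix.of fun i j => q.2 (i, j)) *ᵥ q.1.2‖ₑ ^ 4
  have hF : Measurable F := by
    refine Measurable.indicator ?_
      (measurableSet_le (measurable_specNorm_of.comp measurable_snd) measurable_const)
    have hc : Continuous fun q : ((ι → ℂ) × (ι → ℂ)) × (ι × ι → ℂ) =>
        star q.1.1 ⬝ᵥ (Matrix.of fun i j => q.2 (i, j)) *ᵥ q.1.2 := by
      simp only [dotProduct, mulVec, Matrix.of_apply, Pi.star_apply]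
      fun_prop
    exact hc.measurable.enorm.pow_const 4
  have hJ : Measurable fun ω => ((x ω, y ω), fun p : ι × ι => A ω p.1 p.2) :=
    (hx.prodMk hy).prodMk hA
  have hFJ : {ω | specNorm (A ω) ≤ C}.indicator (fun ω => ‖star (x ω) ⬝ᵥ A ω *ᵥ y ω‖ₑ ^ 4)
      = fun ω => F ((x ω, y ω), fun p : ι × ι => A ω p.1 p.2) := by
    funext ω
    have hof : (Matrix.of fun i j => A ω i j) = A ω := rfl
    simp only [F, Set.indicator, Set.mem_ofPred_eq, hof]
  rw [hFJ]
  refine ⟨hF.comp hJ, ?_⟩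
  have : IsProbabilityMeasure (μ.map fun ω (p : ι × ι) => A ω p.1 p.2) :=
    Measure.isProbabilityMeasure_map hA.aemeasurable
  rw [← lintegral_map hF hJ,
    hxyA.map_prod_eq_prod_map_map (hx.prodMk hy).aemeasurable hA.aemeasurable,
    hxy.map_prod_eq_prod_map_map hx.aemeasurable hy.aemeasurable, hxlaw, hylaw,
    lintegral_prod_symm' _ hF]
  refine (lintegral_mono (g := fun _ => ENNReal.ofReal ((4 + 3 * ∫ z, ‖z‖ ^ 4 ∂ν) * C ^ 4 *
    ((∫ z, ‖z‖ ^ 4 ∂ν) * (Fintype.card ι : ℝ) ^ 2))) fun a => ?_).trans (by simp)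
  rw [lintegral_prod_symm' (fun p => F (p, a)) (hF.comp measurable_prodMk_right)]
  by_cases ha : specNorm (Matrix.of fun i j => a (i, j)) ≤ C
  · simpa [F, Set.indicator, ha] using
      lintegral_lintegral_enorm_bilinear_pow_four_le hmean hvar hL _ ha
  · simp [F, ha]

end BilinearForm

/-- Bilinear-form lemma: if `x_N, y_N` have i.i.d. entries of zero mean, unit
variance and finite eighth moment (common law `ν`), with `x_N`, `y_N` and the
random matrix `A_N` mutually independent, and the spectral norms of `A_N` are
almost surely bounded (uniformly in `N`), then
`(1/N) x_Nᴴ A_N y_N → 0` almost surely. -/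
theorem stmt5 {Ω : Type*} [MeasurableSpace Ω] (μ : Measure Ω) [IsProbabilityMeasure μ]
    (A : ∀ N : ℕ, Ω → Matrix (Fin N) (Fin N) ℂ)
    (x y : ∀ N : ℕ, Ω → (Fin N → ℂ))
    (ν : Measure ℂ) [IsProbabilityMeasure ν]
    (hmean : ∫ z, z ∂ν = 0)
    (hvar : ∫ z, ‖z‖ ^ 2 ∂ν = 1)
    (hmom8 : Integrable (fun z : ℂ => ‖z‖ ^ 8) ν)
    (hxmeas : ∀ N, Measurable (x N)) (hymeas : ∀ N, Measurable (y N))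
    (hAmeas : ∀ N, Measurable fun ω (p : Fin N × Fin N) => A N ω p.1 p.2)
    (hxlaw : ∀ N, Measure.map (x N) μ = Measure.pi fun _ : Fin N => ν)
    (hylaw : ∀ N, Measure.map (y N) μ = Measure.pi fun _ : Fin N => ν)
    (hxy : ∀ N, IndepFun (x N) (y N) μ)
    (hxyA : ∀ N, IndepFun (fun ω => (x N ω, y N ω))
      (fun ω (p : Fin N × Fin N) => A N ω p.1 p.2) μ)
    (hbound : ∀ᵐ ω ∂μ, ∃ C : ℝ, ∀ N, specNorm (A N ω) ≤ C) :
    ∀ᵐ ω ∂μ, Tendsto (fun N : ℕ =>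
        (N : ℂ)⁻¹ * (star (x N ω) ⬝ᵥ (A N ω).mulVec (y N ω)))
      atTop (nhds 0) := by
  have hL : MemLp (fun z : ℂ => z) 4 ν := by
    have h4 : Integrable (fun z : ℂ => ‖z‖ ^ 4) ν :=
      integrable_norm_pow_of_le (f := fun z : ℂ => z) (by fun_prop) (by norm_num : 4 ≤ 8) hmom8
    refine (integrable_norm_rpow_iff (by fun_prop) (by norm_num) (by norm_num)).1 ?_
    simpa using h4
  have hmain : ∀ C : ℕ, ∀ᵐ ω ∂μ, ∑' N : ℕ, ‖(N : ℂ)⁻¹‖ₑ ^ 4 *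
      {ω | specNorm (A N ω) ≤ C}.indicator
        (fun ω => ‖star (x N ω) ⬝ᵥ A N ω *ᵥ y N ω‖ₑ ^ 4) ω < ∞ := by
    intro C
    have hN := fun N => lintegral_indicator_enorm_bilinear_pow_four_le hmean hvar hL (hxmeas N)
      (hymeas N) (hAmeas N) (hxlaw N) (hylaw N) (hxy N) (hxyA N) C
    have hmeas := fun N : ℕ => (hN N).1.const_mul (‖(N : ℂ)⁻¹‖ₑ ^ 4)
    refine ae_lt_top (Measurable.tsum hmeas) ?_
    rw [lintegral_tsum fun N => (hmeas N).aemeasurable]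
    have hm : 0 ≤ ∫ z, ‖z‖ ^ 4 ∂ν := integral_nonneg fun z => by positivity
    set K : ℝ := (4 + 3 * ∫ z, ‖z‖ ^ 4 ∂ν) * (C : ℝ) ^ 4 * ∫ z, ‖z‖ ^ 4 ∂ν with hK
    have hsum : Summable fun N : ℕ => K * ((N : ℝ) ^ 2)⁻¹ :=
      (Real.summable_nat_pow_inv.2 (by norm_num)).mul_left K
    refine ne_top_of_le_ne_top hsum.tsum_ofReal_ne_top (ENNReal.tsum_le_tsum fun N => ?_)
    rw [lintegral_const_mul _ (hN N).1]
    refine (mul_le_mul_right (hN N).2 _).trans ?_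
    rw [← ofReal_norm, ← ENNReal.ofReal_pow (norm_nonneg _),
      ← ENNReal.ofReal_mul (by positivity)]
    refine ENNReal.ofReal_le_ofReal (le_of_eq ?_)
    rw [norm_inv, Complex.norm_natCast, Fintype.card_fin, ← mul_assoc _ _ ((N : ℝ) ^ 2), ← hK]
    rcases eq_or_ne (N : ℝ) 0 with h0 | h0
    · simp [h0]
    · field_simp
  filter_upwards [ae_all_iff.2 hmain, hbound] with ω hω ⟨C, hC⟩
  obtain ⟨k, hk⟩ := exists_nat_ge C
  have hlim := ENNReal.tendsto_atTop_zero_of_tsum_ne_top (hω k).ne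
  simp only [Set.indicator, Set.mem_ofPred_eq, fun N => (hC N).trans hk, if_true, ← mul_pow,
    ← enorm_mul] at hlim
  have hlim4 := (ENNReal.tendsto_toReal ENNReal.zero_ne_top).comp hlim
  have hpow : Tendsto (fun N : ℕ =>
      ‖(N : ℂ)⁻¹ * (star (x N ω) ⬝ᵥ (A N ω).mulVec (y N ω))‖ ^ 4) atTop (nhds 0) := by
    simpa [Function.comp_def] using hlim4
  rw [tendsto_zero_iff_norm_tendsto_zero]
  have hroot := hpow.rpow_const (p := ((4 : ℕ) : ℝ)⁻¹) (.inr (by positivity))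
  simpa only [Real.pow_rpow_inv_natCast (norm_nonneg _) four_ne_zero,
    Real.zero_rpow (by norm_num : ((4 : ℕ) : ℝ)⁻¹ ≠ 0)] using hroot
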